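/- Let d ≥ 3, let S ⊆ {1,…,d} be nonempty with even cardinality |S| ≥ 2, let D₁ = D_{1-2/d} be the product measure on {-1,1}^d with i.i.d. coordinates of mean 1-2/d, let D₂ be the distribution obtained by first drawing l uniformly from {d, d-2, …, -d} and then drawing x uniformly from the slice {x : ∑_i x_i = l}, and let D' = (1/2)·D₁ + (1/2)·D₂. Then E_{x∼D'}[χ_S(x)·x_i] = (1/2)(1-2/d)^{|S|-1} for every i ∈ S, and E_{x∼D'}[χ_S(x)·x_i] = (1/2)(1-2/d)^{|S|+1} for every i ∉ S. -/

import Mathlib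

open Finset

/-- The ±1 real value of a Boolean coordinate of the hypercube `{-1,1}^d`. -/
noncomputable def sgn (b : Bool) : ℝ := if b then 1 else -1

/-- Weight of a point `x` under the product probability measure `D_μ` on `{-1,1}^d` whose
coordinates are i.i.d. with value `1` having probability `(1+μ)/2` (mean `μ`). -/
noncomputable def wMu (d : ℕ) (μ : ℝ) (x : Fin d → Bool) : ℝ :=
  ∏ i, (if x i then (1 + μ) / 2 else (1 - μ) / 2)

/-- The parity function `χ_S(x) = ∏_{i ∈ S} x_i` on the hypercube `{-1,1}^d`. -/
noncomputable def chi (d : ℕ) (S : Finset (Fin d)) (x : Fin d → Bool) : ℝ :=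
  ∏ i ∈ S, sgn (x i)

open Classical in
/-- Weight of `x` under the distribution `D₂` on `{-1,1}^d` obtained by first drawing
`l` uniformly from the `d+1` values `{d, d-2, …, -d}` (which are exactly the possible
values of `∑_i x_i`) and then drawing `x` uniformly from the slice
`{x : ∑_i x_i = l}`.  Thus the weight of `x` is `1/(d+1)` times one over the
cardinality of the slice containing `x`. -/
noncomputable def w2 (d : ℕ) (x : Fin d → Bool) : ℝ :=
  (1 / ((d : ℝ) + 1)) *
    (1 / ((Finset.univ.filter
      (fun y : Fin d → Bool => (∑ i, sgn (y i)) = ∑ i, sgn (x i))).card : ℝ))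

lemma sgn_mul_self (b : Bool) : sgn b * sgn b = 1 := by
  cases b <;> simp [sgn]

lemma sgn_not (b : Bool) : sgn (!b) = -sgn b := by
  cases b <;> simp [sgn]

lemma sum_wMu_mul_chi (d : ℕ) (μ : ℝ) (T : Finset (Fin d)) :
    ∑ x : Fin d → Bool, wMu d μ x * chi d T x = μ ^ T.card := by
  have hfactor : ∀ x : Fin d → Bool, wMu d μ x * chi d T x =
      ∏ j, ((if x j then (1 + μ) / 2 else (1 - μ) / 2) * if j ∈ T then sgn (x j) else 1) := by
    intro x
    rw [Finset.prod_mul_distrib, Fintype.prod_ite_mem]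
    rfl
  have hcoord : ∀ j : Fin d, ∑ b : Bool,
      ((if b then (1 + μ) / 2 else (1 - μ) / 2) * if j ∈ T then sgn b else 1) =
        if j ∈ T then μ else 1 := by
    intro j
    by_cases hj : j ∈ T
    · simp [hj, sgn]
      ring
    · simp [hj]
      ring
  have hprod := Finset.prod_univ_sum (fun _ : Fin d => (Finset.univ : Finset Bool))
    (fun j b => (if b then (1 + μ) / 2 else (1 - μ) / 2) * if j ∈ T then sgn b else 1)
  rw [Fintype.piFinset_univ] at hprod
  simp_rw [hfactor]
  rw [← hprod]
  simp_rw [hcoord]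
  simp [Finset.prod_ite_mem]

lemma w2_not (d : ℕ) (x : Fin d → Bool) : w2 d (fun j => !x j) = w2 d x := by
  classical
  unfold w2
  congr 3
  have hinv : Function.Involutive (fun (y : Fin d → Bool) j => !y j) := fun y => by simp
  refine Finset.card_equiv hinv.toPerm fun y => ?_
  simp only [Finset.mem_filter, Finset.mem_univ, true_and, Function.Involutive.coe_toPerm,
    sgn_not, Finset.sum_neg_distrib]
  constructor <;> intro h <;> linarith

lemma chi_not_of_odd (d : ℕ) {T : Finset (Fin d)} (hT : Odd T.card) (x : Fin d → Bool) :
    chi d T (fun j => !x j) = -chi d T x := by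
  simp [chi, sgn_not, Finset.prod_neg, hT.neg_one_pow]

lemma sum_w2_mul_chi_of_odd (d : ℕ) {T : Finset (Fin d)} (hT : Odd T.card) :
    ∑ x : Fin d → Bool, w2 d x * chi d T x = 0 := by
  have hinv : Function.Involutive (fun (y : Fin d → Bool) j => !y j) := fun y => by simp
  have h := Equiv.sum_comp hinv.toPerm (fun x => w2 d x * chi d T x)
  simp only [Function.Involutive.coe_toPerm, w2_not, chi_not_of_odd d hT, mul_neg,
    Finset.sum_neg_distrib] at h
  linarith

lemma sum_mixture_mul_chi_of_odd (d : ℕ) (μ : ℝ) {T : Finset (Fin d)} (hT : Odd T.card) :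
    ∑ x : Fin d → Bool, ((1 / 2) * wMu d μ x + (1 / 2) * w2 d x) * chi d T x =
      (1 / 2) * μ ^ T.card := by
  simp only [add_mul, mul_assoc, Finset.sum_add_distrib, ← Finset.mul_sum,
    sum_wMu_mul_chi, sum_w2_mul_chi_of_odd d hT, mul_zero, add_zero]

lemma chi_mul_sgn_of_mem (d : ℕ) {S : Finset (Fin d)} {i : Fin d} (hi : i ∈ S)
    (x : Fin d → Bool) : chi d S x * sgn (x i) = chi d (S.erase i) x := by
  rw [chi, chi, ← Finset.prod_erase_mul S _ hi, mul_assoc, sgn_mul_self, mul_one]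

lemma chi_mul_sgn_of_notMem (d : ℕ) {S : Finset (Fin d)} {i : Fin d} (hi : i ∉ S)
    (x : Fin d → Bool) : chi d S x * sgn (x i) = chi d (insert i S) x := by
  rw [chi, chi, Finset.prod_insert hi, mul_comm]

/-- For `d ≥ 3` and nonempty `S` of even cardinality `|S| ≥ 2`, under the mixture
`D' = (1/2)·D_{1-2/d} + (1/2)·D₂` one has
`E_{x∼D'}[χ_S(x)·x_i] = (1/2)(1-2/d)^(|S|-1)` for `i ∈ S` and
`E_{x∼D'}[χ_S(x)·x_i] = (1/2)(1-2/d)^(|S|+1)` for `i ∉ S`. -/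
theorem stmt15 (d : ℕ) (hd : 3 ≤ d) (S : Finset (Fin d))
    (hS : 2 ≤ S.card) (heven : Even S.card) (i : Fin d) :
    ∑ x : Fin d → Bool,
        ((1 / 2) * wMu d (1 - 2 / (d : ℝ)) x + (1 / 2) * w2 d x) *
          (chi d S x * sgn (x i)) =
      if i ∈ S then (1 / 2) * (1 - 2 / (d : ℝ)) ^ (S.card - 1)
      else (1 / 2) * (1 - 2 / (d : ℝ)) ^ (S.card + 1) := by
  split_ifs with hi
  · have hodd : Odd (S.erase i).card := by
      rw [Finset.card_erase_of_mem hi]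
      exact Nat.Even.sub_odd (by omega) heven odd_one
    simp_rw [chi_mul_sgn_of_mem d hi]
    rw [sum_mixture_mul_chi_of_odd d _ hodd, Finset.card_erase_of_mem hi]
  · have hodd : Odd (insert i S).card := by
      rw [Finset.card_insert_of_notMem hi]
      exact heven.add_one
    simp_rw [chi_mul_sgn_of_notMem d hi]
    rw [sum_mixture_mul_chi_of_odd d _ hodd, Finset.card_insert_of_notMem hi]
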